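/- arXiv:1407.3385 — 2 statements merged into one kernel-verified Lean document; each statement's English description precedes it below -/
import Mathlib

section
/- Let (λ_i)_{1≤i≤n} be positive reals and (μ_i^l)_{1≤i≤n, 1≤l≤L} nonnegative reals. Then C(λ_1,μ_1)·C(λ_2,μ_2)⋯C(λ_n,μ_n) = Λ^{-1} · M(λ_1,μ_1)·M(λ_2,μ_2)⋯M(λ_n,μ_n) · Λ. -/
open Finset

/-- The matrix `M(λ,μ)`: every row is `(μ^1/λ, …, μ^L/λ)` with an extra `1` added on the
subdiagonal (`(j,k)` entry is `μ^k/λ + 1` if `k = j - 1` and `μ^k/λ` otherwise). -/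
noncomputable def Mmat (L : ℕ) (lam : ℝ) (mu : Fin L → ℝ) : Matrix (Fin L) (Fin L) ℝ :=
  Matrix.of fun j k => mu k / lam + if (k : ℕ) + 1 = (j : ℕ) then 1 else 0

/-- `a(k) = (μ^k + μ^{k+1} + ⋯ + μ^L)/λ` (with `0`-based index `k`). -/
noncomputable def aCoef (L : ℕ) (lam : ℝ) (mu : Fin L → ℝ) (k : Fin L) : ℝ :=
  (∑ l ∈ Finset.univ.filter fun l : Fin L => (k : ℕ) ≤ (l : ℕ), mu l) / lam

/-- The matrix `C(λ,μ)`: first row `(a(1), …, a(L))`, and `j`-th row (`2 ≤ j ≤ L`)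
the standard basis row vector `e_{j-1}`. -/
noncomputable def Cmat (L : ℕ) (lam : ℝ) (mu : Fin L → ℝ) : Matrix (Fin L) (Fin L) ℝ :=
  Matrix.of fun j k =>
    if (j : ℕ) = 0 then aCoef L lam mu k
    else if (k : ℕ) + 1 = (j : ℕ) then 1 else 0

/-- The `L × L` lower-triangular all-ones matrix `Λ`. -/
def lowerOnes (L : ℕ) : Matrix (Fin L) (Fin L) ℝ :=
  Matrix.of fun j k => if (k : ℕ) ≤ (j : ℕ) then 1 else 0

theorem lowerOnes_det (L : ℕ) : (lowerOnes L).det = 1 := by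
  rw [Matrix.det_of_lowerTriangular]
  · simp [lowerOnes]
  · intro i j hij
    have : i < j := hij
    simp [lowerOnes, this]

theorem sum_left_aux (L : ℕ) (hL : 1 ≤ L) (j k : Fin L) (a : ℝ) :
    (∑ i : Fin L, (if (i : ℕ) ≤ (j : ℕ) then (1 : ℝ) else 0) *
      (if (i : ℕ) = 0 then a else if (k : ℕ) + 1 = (i : ℕ) then 1 else 0)) =
    a + if (k : ℕ) + 1 ≤ (j : ℕ) then 1 else 0 := by
  have h : ∀ i : Fin L, (if (i : ℕ) ≤ (j : ℕ) then (1 : ℝ) else 0) *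
      (if (i : ℕ) = 0 then a else if (k : ℕ) + 1 = (i : ℕ) then 1 else 0) =
      (if i = ⟨0, hL⟩ then a else 0) +
      (if (k : ℕ) + 1 = (i : ℕ) ∧ (k : ℕ) + 1 ≤ (j : ℕ) then 1 else 0) := by
    intro i
    simp only [Fin.ext_iff]
    grind
  simp only [h]
  rw [Finset.sum_add_distrib, Finset.sum_ite_eq' Finset.univ]
  simp only [Finset.mem_univ, if_true]
  congr 1
  by_cases hkj : (k : ℕ) + 1 ≤ (j : ℕ)
  · rw [Finset.sum_eq_single (⟨(k : ℕ) + 1, by omega⟩ : Fin L)]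
    · simp
    · intro b _ hb
      rw [if_neg]
      rintro ⟨h1, _⟩
      exact hb (Fin.ext h1.symm)
    · simp
  · simp [hkj]

theorem sum_right_aux (L : ℕ) (j k : Fin L) :
    (∑ l : Fin L, (if (l : ℕ) + 1 = (j : ℕ) then (1 : ℝ) else 0) *
      (if (k : ℕ) ≤ (l : ℕ) then 1 else 0)) =
    if (k : ℕ) + 1 ≤ (j : ℕ) then 1 else 0 := by
  by_cases hj : (j : ℕ) = 0
  · simp [hj]
  · rw [Finset.sum_eq_single (⟨(j : ℕ) - 1, by omega⟩ : Fin L)]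
    · grind
    · intro b _ hb
      rw [if_neg, zero_mul]
      intro h1
      exact hb (Fin.ext (by simp; omega))
    · simp

theorem intertwine (L : ℕ) (hL : 1 ≤ L) (x : ℝ) (mu : Fin L → ℝ) :
    lowerOnes L * Cmat L x mu = Mmat L x mu * lowerOnes L := by
  ext j k
  simp only [Matrix.mul_apply, lowerOnes, Cmat, Mmat, Matrix.of_apply]
  rw [sum_left_aux L hL]
  simp only [add_mul]
  rw [Finset.sum_add_distrib, sum_right_aux]
  congr 1
  simp only [aCoef, Finset.sum_div, Finset.sum_filter, mul_ite, mul_one, mul_zero,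
    ite_div, zero_div]

/-- For positive reals `λ_1, …, λ_n` and nonnegative reals `μ_i^l`,
`C(λ_1,μ_1) ⋯ C(λ_n,μ_n) = Λ⁻¹ · M(λ_1,μ_1) ⋯ M(λ_n,μ_n) · Λ`. -/
theorem stmt_3 (L : ℕ) (hL : 1 ≤ L) (n : ℕ)
    (lam : Fin n → ℝ) (mu : Fin n → Fin L → ℝ)
    (hlam : ∀ i, 0 < lam i) (hmu : ∀ i l, 0 ≤ mu i l) :
    ((List.finRange n).map fun i => Cmat L (lam i) (mu i)).prod =
      (lowerOnes L)⁻¹ *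
        ((List.finRange n).map fun i => Mmat L (lam i) (mu i)).prod *
        lowerOnes L := by
  have key : ∀ l : List (Fin n),
      lowerOnes L * (l.map fun i => Cmat L (lam i) (mu i)).prod =
        (l.map fun i => Mmat L (lam i) (mu i)).prod * lowerOnes L := by
    intro l
    induction l with
    | nil => simp
    | cons b t ih =>
      simp only [List.map_cons, List.prod_cons]
      rw [← Matrix.mul_assoc, intertwine L hL, Matrix.mul_assoc, ih, Matrix.mul_assoc]
  rw [Matrix.mul_assoc, ← key, ← Matrix.mul_assoc, Matrix.nonsing_inv_mul, Matrix.one_mul]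
  rw [lowerOnes_det]
  exact isUnit_one
end

section
/- Let n ≥ L and for 1 ≤ i ≤ n let λ_i > 0 and μ_i^1, …, μ_i^L ≥ 0 with μ_i^L > 0. Then every entry of the product M(λ_1,μ_1)·M(λ_2,μ_2)⋯M(λ_n,μ_n) is strictly positive. -/
theorem aux_prod (L : ℕ) (hL : 1 ≤ L) (l : List (Matrix (Fin L) (Fin L) ℝ))
    (h : ∀ A ∈ l, (∀ j k, 0 ≤ A j k) ∧ (∀ j, 0 < A j ⟨L - 1, by omega⟩) ∧
      (∀ j k : Fin L, (k : ℕ) + 1 = (j : ℕ) → 0 < A j k)) :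
    (∀ j k, 0 ≤ l.prod j k) ∧ (∀ j, ∃ k, 0 < l.prod j k) ∧
      (∀ j k : Fin L, L ≤ (k : ℕ) + l.length → 0 < l.prod j k) := by
  induction l using List.reverseRecOn with
  | nil =>
    refine ⟨fun j k => ?_, fun j => ⟨j, by simp⟩, fun j k hk => ?_⟩
    · simp only [List.prod_nil, Matrix.one_apply]
      split_ifs <;> norm_num
    · have := k.2
      simp at hk
      omega
  | append_singleton l A ih =>
    obtain ⟨h1, h2, h3⟩ := ih (fun B hB => h B (by simp [hB]))
    obtain ⟨a1, a2, a3⟩ := h A (by simp)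
    have key : ∀ j m k, 0 < l.prod j m → 0 < A m k → 0 < (l ++ [A]).prod j k := by
      intro j m k hp hA
      rw [List.prod_append, List.prod_singleton, Matrix.mul_apply]
      exact Finset.sum_pos' (fun i _ => mul_nonneg (h1 j i) (a1 i k))
        ⟨m, Finset.mem_univ _, mul_pos hp hA⟩
    have last : ∀ j, 0 < (l ++ [A]).prod j ⟨L - 1, by omega⟩ := by
      intro j
      obtain ⟨m, hm⟩ := h2 j
      exact key j m _ hm (a2 m)
    refine ⟨fun j k => ?_, fun j => ⟨_, last j⟩, fun j k hk => ?_⟩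
    · rw [List.prod_append, List.prod_singleton, Matrix.mul_apply]
      exact Finset.sum_nonneg (fun i _ => mul_nonneg (h1 j i) (a1 i k))
    · by_cases hk1 : (k : ℕ) + 1 < L
      · refine key j ⟨k + 1, hk1⟩ k (h3 _ _ ?_) (a3 _ _ rfl)
        simp at hk ⊢
        omega
      · have : k = ⟨L - 1, by omega⟩ := by
          apply Fin.ext
          have := k.2
          simp
          omega
        rw [this]
        exact last j

/-- Let `n ≥ L ≥ 1` and for `1 ≤ i ≤ n` let `λ_i > 0` and `μ_i^1, …, μ_i^L ≥ 0` with
`μ_i^L > 0`. Then every entry of `M(λ_1,μ_1) ⋯ M(λ_n,μ_n)` is strictly positive. -/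
theorem stmt_7 (L : ℕ) (hL : 1 ≤ L) (n : ℕ) (hn : L ≤ n)
    (lam : Fin n → ℝ) (mu : Fin n → Fin L → ℝ)
    (hlam : ∀ i, 0 < lam i) (hmu : ∀ i l, 0 ≤ mu i l)
    (hmuL : ∀ i, 0 < mu i ⟨L - 1, by omega⟩) :
    ∀ j k : Fin L,
      0 < ((List.finRange n).map fun i => Mmat L (lam i) (mu i)).prod j k := by
  intro j k
  refine (aux_prod L hL _ ?_).2.2 j k (by simp; omega)
  intro A hA
  obtain ⟨i, -, rfl⟩ := List.mem_map.1 hA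
  have h0 : ∀ k, 0 ≤ mu i k / lam i := fun k => div_nonneg (hmu i k) (hlam i).le
  refine ⟨fun j k => ?_, fun j => ?_, fun j k hjk => ?_⟩
  · have := h0 k
    simp only [Mmat, Matrix.of_apply]
    split_ifs <;> linarith
  · have := div_pos (hmuL i) (hlam i)
    simp only [Mmat, Matrix.of_apply]
    split_ifs <;> linarith
  · have := h0 k
    simp only [Mmat, Matrix.of_apply, hjk, if_true]
    linarith
end
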